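/- arXiv:1511.01173 — 3 statements merged into one kernel-verified Lean document; each statement's English description precedes it below -/
import Mathlib

section
/- Let X be a Banach space and let h ∈ L¹((0,∞)) be nonnegative. Let T be a bounded linear operator on C⁰_b([0,∞),X) such that (Tf)*(x) ≤ ∫_x^∞ h(t) f*(t) dt for every f ∈ C⁰_b([0,∞),X) and every x ≥ 0. Then I − T is invertible on C⁰_b([0,∞),X): for every f ∈ C⁰_b([0,∞),X) the integral equation u = f + Tu has a unique solution u ∈ C⁰_b([0,∞),X), and moreover ‖(I−T)^{-1}‖ ≤ exp(∫_0^∞ h(t) dt). -/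
open MeasureTheory Filter Set
open scoped Topology NNReal BoundedContinuousFunction

/-- `fstar f x = sup_{y ≥ x} ‖f y‖` for a bounded continuous function on `[0,∞) ≃ ℝ≥0`,
written as a supremum over `y = x + y'` with `y' : ℝ≥0`. -/
noncomputable def fstar {X : Type*} [NormedAddCommGroup X]
    (f : BoundedContinuousFunction ℝ≥0 X) (x : ℝ≥0) : ℝ :=
  ⨆ y : ℝ≥0, ‖f (x + y)‖

theorem AbsolutelyContinuousOnInterval.fun_pow {F : ℝ → ℝ} {a b : ℝ}
    (hF : AbsolutelyContinuousOnInterval F a b) (n : ℕ) :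
    AbsolutelyContinuousOnInterval (fun x ↦ F x ^ n) a b := by
  induction n with
  | zero =>
    simpa using (LipschitzWith.const (1 : ℝ)).lipschitzOnWith.absolutelyContinuousOnInterval
  | succ n ih => simpa only [pow_succ] using ih.fun_mul hF

section Tail

variable {g : ℝ → ℝ}

theorem tail_eq_sub (hg : Integrable g) (a x : ℝ) :
    ∫ s in Ioi x, g s = (∫ s in Ioi a, g s) - ∫ s in a..x, g s := by
  rw [← intervalIntegral.integral_Ioi_sub_Ioi' hg.integrableOn hg.integrableOn]
  ring

theorem tail_nonneg (hg0 : ∀ t, 0 ≤ g t) (x : ℝ) : 0 ≤ ∫ s in Ioi x, g s :=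
  integral_nonneg hg0

theorem tail_antitone (hg : Integrable g) (hg0 : ∀ t, 0 ≤ g t) :
    Antitone fun x : ℝ ↦ ∫ s in Ioi x, g s := fun _ _ hxy ↦
  setIntegral_mono_set hg.integrableOn (.of_forall hg0)
    (LE.le.eventuallyLE (Ioi_subset_Ioi hxy))

theorem integrable_mul_tail_pow (hg : Integrable g) (hg0 : ∀ t, 0 ≤ g t) (n : ℕ) :
    Integrable fun t ↦ g t * (∫ s in Ioi t, g s) ^ n := by
  refine hg.mul_bdd (c := (∫ s, g s) ^ n)
    ((tail_antitone hg hg0).measurable.pow_const n).aestronglyMeasurable (.of_forall fun t ↦ ?_)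
  rw [Real.norm_of_nonneg (pow_nonneg (tail_nonneg hg0 t) n)]
  exact pow_le_pow_left₀ (tail_nonneg hg0 t)
    (setIntegral_le_integral hg (.of_forall hg0)) n

theorem intervalIntegral_mul_tail_pow (hg : Integrable g) (n : ℕ) (a b : ℝ) :
    ∫ t in a..b, g t * (∫ s in Ioi t, g s) ^ n =
      ((∫ s in Ioi a, g s) ^ (n + 1) - (∫ s in Ioi b, g s) ^ (n + 1)) / (n + 1) := by
  have hn : (n + 1 : ℝ) ≠ 0 := by positivity
  have hgi : IntervalIntegrable g volume a b := hg.intervalIntegrable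
  have hac : AbsolutelyContinuousOnInterval (fun x ↦ ∫ s in Ioi x, g s) a b := by
    rw [funext fun x ↦ tail_eq_sub hg a x]
    exact (LipschitzWith.const _).lipschitzOnWith.absolutelyContinuousOnInterval.fun_sub
      (hgi.absolutelyContinuousOnInterval_intervalIntegral left_mem_uIcc)
  have key := (hac.fun_pow (n + 1)).integral_deriv_eq_sub
  have hder : ∫ x in a..b, deriv (fun x ↦ (∫ s in Ioi x, g s) ^ (n + 1)) x =
      ∫ t in a..b, -(n + 1 : ℝ) * (g t * (∫ s in Ioi t, g s) ^ n) := by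
    refine intervalIntegral.integral_congr_ae ?_
    filter_upwards [hgi.ae_hasDerivAt_integral] with x hx hxm
    have h1 : HasDerivAt (fun x ↦ ∫ s in Ioi x, g s) (-g x) x := by
      rw [funext fun x ↦ tail_eq_sub hg a x]
      exact (hx (uIoc_subset_uIcc hxm) a left_mem_uIcc).const_sub _
    rw [(h1.fun_pow (n + 1)).deriv]
    push_cast
    ring
  rw [hder, intervalIntegral.integral_const_mul] at key
  rw [eq_div_iff hn]
  linarith

theorem setIntegral_Ioi_mul_tail_pow_le (hg : Integrable g) (hg0 : ∀ t, 0 ≤ g t) (n : ℕ) (a : ℝ) :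
    ∫ t in Ioi a, g t * (∫ s in Ioi t, g s) ^ n ≤ (∫ s in Ioi a, g s) ^ (n + 1) / (n + 1) := by
  refine le_of_tendsto' (intervalIntegral_tendsto_integral_Ioi a
    (integrable_mul_tail_pow hg hg0 n).integrableOn tendsto_id) fun b ↦ ?_
  rw [intervalIntegral_mul_tail_pow hg]
  gcongr
  exact sub_le_self _ (pow_nonneg (tail_nonneg hg0 _) _)

end Tail

section Volterra

variable {X : Type*} [NormedAddCommGroup X]

theorem fstar_nonneg (f : ℝ≥0 →ᵇ X) (x : ℝ≥0) : 0 ≤ fstar f x :=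
  Real.iSup_nonneg fun _ ↦ norm_nonneg _

theorem fstar_le_norm (f : ℝ≥0 →ᵇ X) (x : ℝ≥0) : fstar f x ≤ ‖f‖ :=
  ciSup_le fun _ ↦ f.norm_coe_le_norm _

theorem norm_le_fstar_zero (f : ℝ≥0 →ᵇ X) : ‖f‖ ≤ fstar f 0 := by
  refine (BoundedContinuousFunction.norm_le (fstar_nonneg f 0)).2 fun y ↦ ?_
  have hb : BddAbove (range fun y : ℝ≥0 ↦ ‖f (0 + y)‖) :=
    ⟨‖f‖, by rintro _ ⟨y, rfl⟩; exact f.norm_coe_le_norm _⟩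
  simpa [fstar] using le_ciSup hb y

variable [NormedSpace ℝ X] {g : ℝ → ℝ} {T : (ℝ≥0 →ᵇ X) →L[ℝ] (ℝ≥0 →ᵇ X)}

theorem fstar_pow_le (hg : Integrable g) (hg0 : ∀ t, 0 ≤ g t)
    (hT : ∀ (f : ℝ≥0 →ᵇ X) (x : ℝ≥0),
      fstar (T f) x ≤ ∫ t in Ioi (x : ℝ), g t * fstar f t.toNNReal)
    (f : ℝ≥0 →ᵇ X) (n : ℕ) (x : ℝ≥0) :
    fstar ((T ^ n) f) x ≤ ‖f‖ / n.factorial * (∫ s in Ioi (x : ℝ), g s) ^ n := by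
  induction n generalizing x with
  | zero => simpa using fstar_le_norm f x
  | succ n ih =>
    rw [pow_succ', mul_apply_eq_comp]
    calc fstar (T ((T ^ n) f)) x
        ≤ ∫ t in Ioi (x : ℝ), g t * fstar ((T ^ n) f) t.toNNReal := hT _ _
      _ ≤ ∫ t in Ioi (x : ℝ), ‖f‖ / n.factorial * (g t * (∫ s in Ioi t, g s) ^ n) := by
        refine integral_mono_of_nonneg (.of_forall fun t ↦ mul_nonneg (hg0 t) (fstar_nonneg _ _))
          ((integrable_mul_tail_pow hg hg0 n).const_mul _).integrableOn ?_
        filter_upwards [ae_restrict_mem measurableSet_Ioi] with t ht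
        have h1 := ih t.toNNReal
        rw [Real.coe_toNNReal t (x.coe_nonneg.trans (le_of_lt ht))] at h1
        calc g t * fstar ((T ^ n) f) t.toNNReal
            ≤ g t * (‖f‖ / n.factorial * (∫ s in Ioi t, g s) ^ n) :=
              mul_le_mul_of_nonneg_left h1 (hg0 t)
          _ = _ := by ring
      _ ≤ ‖f‖ / n.factorial * ((∫ s in Ioi (x : ℝ), g s) ^ (n + 1) / (n + 1)) := by
        rw [integral_const_mul]
        gcongr
        exact setIntegral_Ioi_mul_tail_pow_le hg hg0 n x
      _ = ‖f‖ / (n + 1).factorial * (∫ s in Ioi (x : ℝ), g s) ^ (n + 1) := by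
        rw [Nat.factorial_succ]
        push_cast
        field_simp

theorem norm_pow_le_tail (hg : Integrable g) (hg0 : ∀ t, 0 ≤ g t)
    (hT : ∀ (f : ℝ≥0 →ᵇ X) (x : ℝ≥0),
      fstar (T f) x ≤ ∫ t in Ioi (x : ℝ), g t * fstar f t.toNNReal) (n : ℕ) :
    ‖T ^ n‖ ≤ (∫ s in Ioi (0 : ℝ), g s) ^ n / n.factorial := by
  refine ContinuousLinearMap.opNorm_le_bound _
    (div_nonneg (pow_nonneg (tail_nonneg hg0 0) n) (by positivity)) fun f ↦ ?_
  calc ‖(T ^ n) f‖ ≤ fstar ((T ^ n) f) 0 := norm_le_fstar_zero _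
    _ ≤ ‖f‖ / n.factorial * (∫ s in Ioi (0 : ℝ), g s) ^ n := fstar_pow_le hg hg0 hT f n 0
    _ = _ := by ring

end Volterra

/-- Volterra-type integral equations: if `T` is a bounded operator on
`C⁰_b([0,∞), X)` satisfying `(Tf)*(x) ≤ ∫_x^∞ h(t) f*(t) dt` for a nonnegative
`h ∈ L¹((0,∞))`, then `I - T` is invertible: every equation `u = f + T u` has a
unique solution, and the resolvent norm is bounded by `exp(∫_0^∞ h)`. -/
theorem stmt0 {X : Type*} [NormedAddCommGroup X] [NormedSpace ℝ X] [CompleteSpace X]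
    (h : ℝ → ℝ) (hh0 : ∀ t ∈ Set.Ioi (0 : ℝ), 0 ≤ h t)
    (hh1 : IntegrableOn h (Set.Ioi (0 : ℝ)))
    (T : BoundedContinuousFunction ℝ≥0 X →L[ℝ] BoundedContinuousFunction ℝ≥0 X)
    (hT : ∀ (f : BoundedContinuousFunction ℝ≥0 X) (x : ℝ≥0),
      fstar (T f) x ≤ ∫ t in Set.Ioi (x : ℝ), h t * fstar f t.toNNReal) :
    (∀ f : BoundedContinuousFunction ℝ≥0 X, ∃! u, u = f + T u) ∧
      ∀ (f u : BoundedContinuousFunction ℝ≥0 X), u = f + T u →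
        ‖u‖ ≤ Real.exp (∫ t in Set.Ioi (0 : ℝ), h t) * ‖f‖ := by
  have hgeq : ∀ x : ℝ, 0 ≤ x → ∀ t ∈ Ioi x, (Ioi (0 : ℝ)).indicator h t = h t :=
    fun x hx t ht ↦ indicator_of_mem (hx.trans_lt ht : (0 : ℝ) < t) h
  have hg : Integrable ((Ioi (0 : ℝ)).indicator h) := hh1.integrable_indicator measurableSet_Ioi
  have hg0 : ∀ t, 0 ≤ (Ioi (0 : ℝ)).indicator h t := indicator_nonneg hh0
  have hgT : ∀ (f : ℝ≥0 →ᵇ X) (x : ℝ≥0), fstar (T f) x ≤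
      ∫ t in Ioi (x : ℝ), (Ioi (0 : ℝ)).indicator h t * fstar f t.toNNReal := by
    intro f x
    refine (hT f x).trans_eq (setIntegral_congr_fun measurableSet_Ioi fun t ht ↦ ?_)
    simp only [hgeq x x.coe_nonneg t ht]
  have hbound := norm_pow_le_tail hg hg0 hgT
  rw [setIntegral_congr_fun measurableSet_Ioi (hgeq 0 le_rfl)] at hbound
  have hexp := NormedSpace.expSeries_div_hasSum_exp (∫ t in Ioi (0 : ℝ), h t)
  rw [← Real.exp_eq_exp_ℝ] at hexp
  have hsum : Summable (T ^ ·) := .of_norm_bounded hexp.summable hbound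
  have hnorm : ‖∑' n, T ^ n‖ ≤ Real.exp (∫ t in Ioi (0 : ℝ), h t) :=
    tsum_of_norm_bounded hexp hbound
  have hleft : ∀ f u, u = f + T u → u = (∑' n, T ^ n) f := by
    intro f u hu
    have h1 := congrArg (· u) hsum.tsum_pow_mul_one_sub
    have h2 : (1 - T) u = f := by
      simpa [sub_eq_iff_eq_add] using hu
    simpa only [mul_apply_eq_comp, h2, one_apply_eq_self] using h1.symm
  refine ⟨fun f ↦ ⟨(∑' n, T ^ n) f, ?_, hleft f⟩, fun f u hu ↦ ?_⟩
  · have h1 := congrArg (· f) hsum.one_sub_mul_tsum_pow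
    simpa [sub_eq_iff_eq_add] using h1
  · rw [hleft f u hu]
    exact ContinuousLinearMap.le_of_opNorm_le _ hnorm f
end

section
/- Let q : ℝ → ℂ be continuous and let z ∈ ℂ with Im(z²) ≠ 0. Suppose M₁, M₂ : ℝ → M₂(ℂ) are continuously differentiable, bounded on ℝ, satisfy the differential equation M'(x) = −iz² (σ M(x) − M(x) σ) + z Q(x) M(x) + P(x) M(x) for all x ∈ ℝ, and satisfy M_i(x) → 𝟏 (the 2×2 identity matrix) as x → +∞ for i = 1,2. Then M₁ = M₂. The same uniqueness holds when the asymptotic condition is imposed at −∞ instead of +∞. -/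
open Filter Complex
open scoped Topology Matrix

/-- The right-hand side of the spectral problem
`M' = -iz² ad σ (M) + z Q M + P M`, where `σ = diag(1,-1)`,
`Q` has off-diagonal entries `q, \overline{q}` and `P = diag(-(i/2)|q|², (i/2)|q|²)`,
expressed at a point where `q` takes the value `qv`. -/
noncomputable def dnlsRHS (qv : ℂ) (z : ℂ) (M : Matrix (Fin 2) (Fin 2) ℂ) :
    Matrix (Fin 2) (Fin 2) ℂ :=
  (-Complex.I * z ^ 2) •
      (!![(1 : ℂ), 0; 0, -1] * M - M * !![(1 : ℂ), 0; 0, -1]) +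
    z • (!![0, qv; (starRingEnd ℂ) qv, 0] * M) +
    !![-(Complex.I / 2) * ((‖qv‖ ^ 2 : ℝ) : ℂ), 0;
        0, (Complex.I / 2) * ((‖qv‖ ^ 2 : ℝ) : ℂ)] * M

/-- A solution of `f' = k f` that is bounded on the whole line vanishes when `Re k ≠ 0`. -/
lemma eq_zero_of_hasDerivAt_mul_of_bounded {k : ℂ} (hk : k.re ≠ 0) {f : ℝ → ℂ}
    (hf : ∀ x, HasDerivAt f (k * f x) x) {C : ℝ} (hC : ∀ x, ‖f x‖ ≤ C) (x : ℝ) : f x = 0 := by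
  have hexp (y : ℝ) : HasDerivAt (fun t : ℝ => exp (-k * t) * f t) 0 y := by
    refine ((((hasDerivAt_id y).ofReal_comp.const_mul (-k)).cexp).mul (hf y)).congr_deriv ?_
    simp only [id, ofReal_one]
    ring
  have hf_eq (y : ℝ) : f y = exp (k * y) * f 0 := by
    have h := is_const_of_deriv_eq_zero (fun y => (hexp y).differentiableAt)
      (fun y => (hexp y).deriv) y 0
    simp only [ofReal_zero, mul_zero, exp_zero, one_mul] at h
    rw [← h, ← mul_assoc, ← exp_add]
    simp
  suffices h0 : f 0 = 0 by rw [hf_eq x, h0, mul_zero]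
  by_contra h0
  have hpos : 0 < ‖f 0‖ := norm_pos_iff.mpr h0
  have h := hC (C / ‖f 0‖ / k.re)
  rw [hf_eq, norm_mul, norm_exp, re_mul_ofReal, mul_div_cancel₀ _ hk] at h
  have h1 := mul_le_mul_of_nonneg_right (Real.add_one_le_exp (C / ‖f 0‖)) hpos.le
  rw [add_mul, div_mul_cancel₀ _ hpos.ne'] at h1
  linarith

/-- A function with zero derivative that converges along a nontrivial filter equals its limit. -/
lemma eq_of_hasDerivAt_zero_of_tendsto {l : Filter ℝ} [l.NeBot] {f : ℝ → ℂ} {c : ℂ}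
    (hf : ∀ x, HasDerivAt f 0 x) (hlim : Tendsto f l (𝓝 c)) (x : ℝ) : f x = c := by
  have h : f = fun _ => f x := funext fun y =>
    is_const_of_deriv_eq_zero (fun y => (hf y).differentiableAt) (fun y => (hf y).deriv) y x
  rw [h] at hlim
  exact tendsto_nhds_unique tendsto_const_nhds hlim

lemma norm_mul_sub_mul_le {a b c d : ℂ} {A B : ℝ} (ha : ‖a‖ ≤ A) (hb : ‖b‖ ≤ B)
    (hc : ‖c‖ ≤ A) (hd : ‖d‖ ≤ B) : ‖a * b - c * d‖ ≤ A * B + A * B := by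
  have hA : 0 ≤ A := (norm_nonneg a).trans ha
  refine (norm_sub_le _ _).trans ?_
  rw [norm_mul, norm_mul]
  gcongr

section Entries

variable (w z : ℂ) (M : Matrix (Fin 2) (Fin 2) ℂ)

lemma dnlsRHS_zero_zero : dnlsRHS w z M 0 0 =
    z * w * M 1 0 - I / 2 * ((‖w‖ ^ 2 : ℝ) : ℂ) * M 0 0 := by
  simp [dnlsRHS, Matrix.mul_apply, Fin.sum_univ_two, Matrix.vecMul, dotProduct]
  ring

lemma dnlsRHS_zero_one : dnlsRHS w z M 0 1 =
    -2 * I * z ^ 2 * M 0 1 + z * w * M 1 1 - I / 2 * ((‖w‖ ^ 2 : ℝ) : ℂ) * M 0 1 := by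
  simp [dnlsRHS, Matrix.mul_apply, Fin.sum_univ_two, Matrix.vecMul, dotProduct]
  ring

lemma dnlsRHS_one_zero : dnlsRHS w z M 1 0 =
    2 * I * z ^ 2 * M 1 0 + z * (starRingEnd ℂ) w * M 0 0 +
      I / 2 * ((‖w‖ ^ 2 : ℝ) : ℂ) * M 1 0 := by
  simp [dnlsRHS, Matrix.mul_apply, Fin.sum_univ_two, Matrix.vecMul, dotProduct]
  ring

lemma dnlsRHS_one_one : dnlsRHS w z M 1 1 =
    z * (starRingEnd ℂ) w * M 0 1 + I / 2 * ((‖w‖ ^ 2 : ℝ) : ℂ) * M 1 1 := by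
  simp [dnlsRHS, Matrix.mul_apply, Fin.sum_univ_two, Matrix.vecMul, dotProduct]
  ring

end Entries

/-- The Wronskian of column `0` of one solution and column `1` of another is constant. -/
lemma hasDerivAt_wronskian_zero_one {q : ℝ → ℂ} {z : ℂ} {M N : ℝ → Matrix (Fin 2) (Fin 2) ℂ}
    (hM : ∀ (x : ℝ) (i j : Fin 2), HasDerivAt (fun t => M t i j) (dnlsRHS (q x) z (M x) i j) x)
    (hN : ∀ (x : ℝ) (i j : Fin 2), HasDerivAt (fun t => N t i j) (dnlsRHS (q x) z (N x) i j) x)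
    (x : ℝ) :
    HasDerivAt (fun t => M t 0 0 * N t 1 1 - M t 1 0 * N t 0 1) 0 x := by
  refine (((hM x 0 0).mul (hN x 1 1)).sub ((hM x 1 0).mul (hN x 0 1))).congr_deriv ?_
  simp only [dnlsRHS_zero_zero, dnlsRHS_zero_one, dnlsRHS_one_zero, dnlsRHS_one_one]
  ring

lemma hasDerivAt_wronskian_zero_zero {q : ℝ → ℂ} {z : ℂ} {M N : ℝ → Matrix (Fin 2) (Fin 2) ℂ}
    (hM : ∀ (x : ℝ) (i j : Fin 2), HasDerivAt (fun t => M t i j) (dnlsRHS (q x) z (M x) i j) x)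
    (hN : ∀ (x : ℝ) (i j : Fin 2), HasDerivAt (fun t => N t i j) (dnlsRHS (q x) z (N x) i j) x)
    (x : ℝ) :
    HasDerivAt (fun t => M t 0 0 * N t 1 0 - M t 1 0 * N t 0 0)
      (2 * I * z ^ 2 * (M x 0 0 * N x 1 0 - M x 1 0 * N x 0 0)) x := by
  refine (((hM x 0 0).mul (hN x 1 0)).sub ((hM x 1 0).mul (hN x 0 0))).congr_deriv ?_
  simp only [dnlsRHS_zero_zero, dnlsRHS_one_zero]
  ring

lemma hasDerivAt_wronskian_one_one {q : ℝ → ℂ} {z : ℂ} {M N : ℝ → Matrix (Fin 2) (Fin 2) ℂ}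
    (hM : ∀ (x : ℝ) (i j : Fin 2), HasDerivAt (fun t => M t i j) (dnlsRHS (q x) z (M x) i j) x)
    (hN : ∀ (x : ℝ) (i j : Fin 2), HasDerivAt (fun t => N t i j) (dnlsRHS (q x) z (N x) i j) x)
    (x : ℝ) :
    HasDerivAt (fun t => M t 0 1 * N t 1 1 - M t 1 1 * N t 0 1)
      (-2 * I * z ^ 2 * (M x 0 1 * N x 1 1 - M x 1 1 * N x 0 1)) x := by
  refine (((hM x 0 1).mul (hN x 1 1)).sub ((hM x 1 1).mul (hN x 0 1))).congr_deriv ?_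
  simp only [dnlsRHS_zero_one, dnlsRHS_one_one]
  ring

lemma tendsto_wronskian_zero_one {l : Filter ℝ} {M N : ℝ → Matrix (Fin 2) (Fin 2) ℂ}
    (hM : ∀ i j : Fin 2,
      Tendsto (fun x => M x i j) l (𝓝 ((1 : Matrix (Fin 2) (Fin 2) ℂ) i j)))
    (hN : ∀ i j : Fin 2,
      Tendsto (fun x => N x i j) l (𝓝 ((1 : Matrix (Fin 2) (Fin 2) ℂ) i j))) :
    Tendsto (fun x => M x 0 0 * N x 1 1 - M x 1 0 * N x 0 1) l (𝓝 1) := by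
  simpa using ((hM 0 0).mul (hN 1 1)).sub ((hM 1 0).mul (hN 0 1))

/-- Uniqueness of Beals–Coifman solutions: two bounded solutions of the linear spectral
problem `M' = -iz² ad σ(M) + zQM + PM` (with `Im z² ≠ 0`) which both tend to the identity
matrix at `+∞` (or both at `-∞`) coincide. -/
theorem stmt12 (q : ℝ → ℂ) (hq : Continuous q) (z : ℂ) (hz : (z ^ 2).im ≠ 0)
    (l : Filter ℝ) (hl : l = atTop ∨ l = atBot)
    (M₁ M₂ : ℝ → Matrix (Fin 2) (Fin 2) ℂ)
    (hode₁ : ∀ (x : ℝ) (i j : Fin 2),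
      HasDerivAt (fun t => M₁ t i j) (dnlsRHS (q x) z (M₁ x) i j) x)
    (hode₂ : ∀ (x : ℝ) (i j : Fin 2),
      HasDerivAt (fun t => M₂ t i j) (dnlsRHS (q x) z (M₂ x) i j) x)
    (hbd₁ : ∃ C : ℝ, ∀ (x : ℝ) (i j : Fin 2), ‖M₁ x i j‖ ≤ C)
    (hbd₂ : ∃ C : ℝ, ∀ (x : ℝ) (i j : Fin 2), ‖M₂ x i j‖ ≤ C)
    (hlim₁ : ∀ i j : Fin 2,
      Tendsto (fun x => M₁ x i j) l (𝓝 ((1 : Matrix (Fin 2) (Fin 2) ℂ) i j)))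
    (hlim₂ : ∀ i j : Fin 2,
      Tendsto (fun x => M₂ x i j) l (𝓝 ((1 : Matrix (Fin 2) (Fin 2) ℂ) i j))) :
    M₁ = M₂ := by
  have : l.NeBot := by rcases hl with rfl | rfl <;> infer_instance
  obtain ⟨C₁, hC₁⟩ := hbd₁
  obtain ⟨C₂, hC₂⟩ := hbd₂
  ext x i j
  have hdet := eq_of_hasDerivAt_zero_of_tendsto (hasDerivAt_wronskian_zero_one hode₁ hode₁)
    (tendsto_wronskian_zero_one hlim₁ hlim₁) x
  have h12 := eq_of_hasDerivAt_zero_of_tendsto (hasDerivAt_wronskian_zero_one hode₁ hode₂)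
    (tendsto_wronskian_zero_one hlim₁ hlim₂) x
  have h21 := eq_of_hasDerivAt_zero_of_tendsto (hasDerivAt_wronskian_zero_one hode₂ hode₁)
    (tendsto_wronskian_zero_one hlim₂ hlim₁) x
  have h00 := eq_zero_of_hasDerivAt_mul_of_bounded
    (by rw [mul_assoc]; simpa using hz)
    (hasDerivAt_wronskian_zero_zero hode₁ hode₂)
    (fun t => norm_mul_sub_mul_le (hC₁ t 0 0) (hC₂ t 1 0) (hC₁ t 1 0) (hC₂ t 0 0)) x
  have h11 := eq_zero_of_hasDerivAt_mul_of_bounded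
    (by rw [mul_assoc]; simpa using hz)
    (hasDerivAt_wronskian_one_one hode₁ hode₂)
    (fun t => norm_mul_sub_mul_le (hC₁ t 0 1) (hC₂ t 1 1) (hC₁ t 1 1) (hC₂ t 0 1)) x
  fin_cases i <;> fin_cases j <;> simp only [Fin.zero_eta, Fin.mk_one, Fin.isValue]
  · linear_combination (-M₁ x 0 0) * h21 + M₂ x 0 0 * hdet - M₁ x 0 1 * h00
  · linear_combination (-M₁ x 0 1) * h12 + M₂ x 0 1 * hdet + M₁ x 0 0 * h11
  · linear_combination (-M₁ x 1 0) * h21 + M₂ x 1 0 * hdet - M₁ x 1 1 * h00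
  · linear_combination (-M₁ x 1 1) * h12 + M₂ x 1 1 * hdet + M₁ x 1 0 * h11
end

section
/- Let u : ℝ × ℝ → ℂ be smooth and satisfy the derivative nonlinear Schrödinger equation ∂_t u = i ∂_x² u + ∂_x(|u|² u) on ℝ × ℝ (equivalently, i u_t + u_{xx} = i (|u|²u)_x). Let φ : ℝ × ℝ → ℝ be smooth with ∂_x φ = (1/2)|u|² and ∂_t φ = −Im( \overline{u} ∂_x u ) + (3/4)|u|⁴. Then the function q := e^{−2iφ} u is a smooth solution of i ∂_t q + ∂_x² q + i q² ∂_x \overline{q} + (1/2)|q|⁴ q = 0 on ℝ × ℝ. -/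
open Complex

/-- The gauge transformation `q = e^{-2iφ} u`, with `φ_x = |u|²/2` and
`φ_t = -Im(\overline{u} u_x) + (3/4)|u|⁴` (so that `φ = (1/2)∫_{-∞}^x |u|² dy` along a
solution), maps smooth solutions of the derivative nonlinear Schrödinger equation
`u_t = i u_{xx} + (|u|²u)_x` to smooth solutions of the Gerjikov–Ivanov equation
`i q_t + q_{xx} + i q² \overline{q}_x + (1/2)|q|⁴ q = 0`. -/
theorem stmt19 (u : ℝ → ℝ → ℂ)
    (hu : ContDiff ℝ (⊤ : ℕ∞) fun p : ℝ × ℝ => u p.1 p.2)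
    (hueq : ∀ x t : ℝ,
      deriv (fun s => u x s) t =
        Complex.I * deriv (fun y => deriv (fun y' => u y' t) y) x +
          deriv (fun y => ((‖u y t‖ ^ 2 : ℝ) : ℂ) * u y t) x)
    (φ : ℝ → ℝ → ℝ)
    (hφ : ContDiff ℝ (⊤ : ℕ∞) fun p : ℝ × ℝ => φ p.1 p.2)
    (hφx : ∀ x t : ℝ, deriv (fun y => φ y t) x = (1 / 2) * ‖u x t‖ ^ 2)
    (hφt : ∀ x t : ℝ,
      deriv (fun s => φ x s) t =
        -((starRingEnd ℂ) (u x t) * deriv (fun y => u y t) x).im +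
          (3 / 4) * ‖u x t‖ ^ 4)
    (q : ℝ → ℝ → ℂ)
    (hqdef : q = fun x t => Complex.exp (-2 * Complex.I * ((φ x t : ℝ) : ℂ)) * u x t) :
    (ContDiff ℝ (⊤ : ℕ∞) fun p : ℝ × ℝ => q p.1 p.2) ∧
      ∀ x t : ℝ,
        Complex.I * deriv (fun s => q x s) t +
            deriv (fun y => deriv (fun y' => q y' t) y) x +
            Complex.I * q x t ^ 2 * deriv (fun y => (starRingEnd ℂ) (q y t)) x +
            (1 / 2) * ((‖q x t‖ ^ 4 : ℝ) : ℂ) * q x t = 0 := by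
  subst hqdef
  have hφc : ContDiff ℝ (⊤ : ℕ∞) fun p : ℝ × ℝ => ((φ p.1 p.2 : ℝ) : ℂ) :=
    ofRealCLM.contDiff.comp hφ
  refine ⟨((contDiff_const.mul hφc).cexp).mul hu, fun x t => ?_⟩
  have hux : ContDiff ℝ (⊤ : ℕ∞) fun y => u y t :=
    hu.comp (contDiff_id.prodMk contDiff_const)
  have hut : ContDiff ℝ (⊤ : ℕ∞) fun s => u x s :=
    hu.comp (contDiff_const.prodMk contDiff_id)
  have hφX : ContDiff ℝ (⊤ : ℕ∞) fun y => φ y t :=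
    hφ.comp (contDiff_id.prodMk contDiff_const)
  have hφT : ContDiff ℝ (⊤ : ℕ∞) fun s => φ x s :=
    hφ.comp (contDiff_const.prodMk contDiff_id)
  have hux' : ContDiff ℝ (⊤ : ℕ∞) (deriv fun y => u y t) :=
    (contDiff_infty_iff_deriv.1 hux).2
  have hu_deriv (y : ℝ) : HasDerivAt (fun y => u y t) (deriv (fun y => u y t) y) y :=
    (hux.differentiable (by simp) y).hasDerivAt
  have hu_deriv₂ : HasDerivAt (deriv fun y => u y t)
      (deriv (fun y => deriv (fun y' => u y' t) y) x) x :=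
    (hux'.differentiable (by simp) x).hasDerivAt
  have hcubic : HasDerivAt (fun y => ((‖u y t‖ ^ 2 : ℝ) : ℂ) * u y t)
      (deriv (fun y => ((‖u y t‖ ^ 2 : ℝ) : ℂ) * u y t) x) x := by
    have hsq : ContDiff ℝ (⊤ : ℕ∞) fun y => ((‖u y t‖ ^ 2 : ℝ) : ℂ) :=
      ofRealCLM.contDiff.comp (hux.norm_sq ℝ)
    exact ((hsq.mul hux).differentiable (by simp) x).hasDerivAt
  have hexp (y : ℝ) : HasDerivAt (fun y => exp (-2 * I * ((φ y t : ℝ) : ℂ)))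
      (exp (-2 * I * ((φ y t : ℝ) : ℂ)) * (-I * ((‖u y t‖ ^ 2 : ℝ) : ℂ))) y := by
    have h := (hφX.differentiable (by simp) y).hasDerivAt
    rw [hφx y t] at h
    refine (h.ofReal_comp.const_mul (-2 * I)).cexp.congr_deriv ?_
    push_cast
    ring
  have hq_deriv (y : ℝ) : HasDerivAt (fun y => exp (-2 * I * ((φ y t : ℝ) : ℂ)) * u y t)
      (exp (-2 * I * ((φ y t : ℝ) : ℂ)) *
        (deriv (fun y => u y t) y - I * (((‖u y t‖ ^ 2 : ℝ) : ℂ) * u y t))) y := by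
    refine ((hexp y).mul (hu_deriv y)).congr_deriv ?_
    ring
  have hq_deriv₂ := (hexp x).mul (hu_deriv₂.sub (hcubic.const_mul I))
  have hq_conj := (hq_deriv x).star
  have hφ_t := (hφT.differentiable (by simp) t).hasDerivAt
  rw [hφt x t] at hφ_t
  have hu_t := (hut.differentiable (by simp) t).hasDerivAt
  rw [hueq x t] at hu_t
  have hq_t := ((hφ_t.ofReal_comp.const_mul (-2 * I)).cexp).mul hu_t
  have e₁ : (fun y => deriv (fun y' => exp (-2 * I * ((φ y' t : ℝ) : ℂ)) * u y' t) y) = _ :=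
    funext fun y => (hq_deriv y).deriv
  have e₂ := hq_t.deriv
  have e₃ := hq_deriv₂.deriv
  have e₄ := hq_conj.deriv
  simp only [Pi.mul_def, Pi.sub_def] at e₂ e₃
  simp only [← starRingEnd_apply] at e₄
  beta_reduce
  rw [e₁, e₂, e₃, e₄]
  generalize deriv (fun y => ((‖u y t‖ ^ 2 : ℝ) : ℂ) * u y t) x = n
  generalize deriv (fun y => deriv (fun y' => u y' t) y) x = c
  generalize deriv (fun y => u y t) x = b
  have hE : ‖exp (-2 * I * ((φ x t : ℝ) : ℂ))‖ = 1 := by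
    rw [norm_exp]
    simp
  rw [norm_mul, hE, one_mul]
  have hEE : exp (-2 * I * ((φ x t : ℝ) : ℂ)) *
      (starRingEnd ℂ) (exp (-2 * I * ((φ x t : ℝ) : ℂ))) = 1 := by
    rw [mul_conj, normSq_eq_norm_sq, hE]
    simp
  generalize exp (-2 * I * ((φ x t : ℝ) : ℂ)) = E at hEE ⊢
  generalize u x t = a
  have hnorm : ((‖a‖ : ℝ) : ℂ) ^ 2 = a * (starRingEnd ℂ) a := (mul_conj' a).symm
  have hnorm₄ : ((‖a‖ : ℝ) : ℂ) ^ 4 = (a * (starRingEnd ℂ) a) ^ 2 := by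
    rw [← hnorm]
    ring
  have him : 2 * ((((starRingEnd ℂ) a * b).im : ℝ) : ℂ) =
      -I * ((starRingEnd ℂ) a * b - a * (starRingEnd ℂ) b) := by
    have h := sub_conj ((starRingEnd ℂ) a * b)
    simp only [map_mul, conj_conj] at h
    rw [h]
    push_cast
    linear_combination (2 * ((((starRingEnd ℂ) a * b).im : ℝ) : ℂ)) * I_sq
  push_cast
  simp only [map_mul, map_sub, conj_I, hnorm, hnorm₄, conj_conj]
  linear_combination
    (I * E * a ^ 2 * ((starRingEnd ℂ) b + I * (a * (starRingEnd ℂ) a ^ 2))) * hEE +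
    (I ^ 2 * E * a) * him +
    (E * (-I * a * ((starRingEnd ℂ) a * b - a * (starRingEnd ℂ) b) +
      1 / 2 * (a * (starRingEnd ℂ) a) ^ 2 * a + c)) * I_sq
end
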